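/- arXiv:1606.06858 — 6 statements merged into one kernel-verified Lean document; each statement's English description precedes it below -/
import Mathlib

section
/- (Diagonal Product Formula) For all natural numbers n, h, k with 1 ≤ h ≤ k ≤ ⌊n/2⌋, the product of diagonals satisfies μ_{n,h}·μ_{n,k} = ∑_{i=1}^{h} μ_{n, k−h−1+2i}, i.e. (sin(hπ/n)/sin(π/n))·(sin(kπ/n)/sin(π/n)) = ∑_{i=1}^{h} sin((k−h−1+2i)π/n)/sin(π/n). -/
open Real

/-- Closed form for a sum of sines along an arithmetic progression of step `2 * x`. -/
theorem sin_mul_sum_sin_add_two_mul (c x : ℝ) (h : ℕ) :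
    sin x * ∑ i ∈ Finset.Icc 1 h, sin ((c + 2 * (i : ℝ)) * x) =
      sin (h * x) * sin ((c + 1 + h) * x) := by
  induction h with
  | zero => simp
  | succ m ih =>
    rw [Finset.sum_Icc_succ_top (by omega), mul_add, ih]
    have h₁ : ((m + 1 : ℕ) : ℝ) * x = m * x + x := by push_cast; ring
    have h₂ : (c + 1 + ((m + 1 : ℕ) : ℝ)) * x = (c + 1 + m) * x + x := by push_cast; ring
    have h₃ : (c + 2 * ((m + 1 : ℕ) : ℝ)) * x = m * x + (c + 1 + m) * x + x := by
      push_cast; ring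
    rw [h₁, h₂, h₃]
    simp only [sin_add, cos_add]
    linear_combination sin (m * x) * sin ((c + 1 + m) * x) * (-sin_sq_add_cos_sq x)

/-- Diagonal Product Formula: for 1 ≤ h ≤ k ≤ ⌊n/2⌋,
μ_{n,h}·μ_{n,k} = ∑_{i=1}^{h} μ_{n, k−h−1+2i}. -/
theorem diagonal_product_formula (n h k : ℕ) (hh : 1 ≤ h) (hhk : h ≤ k) (hkn : k ≤ n / 2) :
    (Real.sin (h * Real.pi / n) / Real.sin (Real.pi / n)) *
      (Real.sin (k * Real.pi / n) / Real.sin (Real.pi / n)) =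
    ∑ i ∈ Finset.Icc 1 h,
      Real.sin (((k : ℝ) - (h : ℝ) - 1 + 2 * (i : ℝ)) * Real.pi / n) / Real.sin (Real.pi / n) := by
  have hn : (1 : ℝ) < n := by exact_mod_cast (by omega : 1 < n)
  have hs : sin (π / n) ≠ 0 :=
    (sin_pos_of_pos_of_lt_pi (by positivity) (div_lt_self pi_pos hn)).ne'
  have key := sin_mul_sum_sin_add_two_mul ((k : ℝ) - h - 1) (π / n) h
  rw [show (k : ℝ) - h - 1 + 1 + h = k by ring] at key
  simp only [mul_div_assoc]
  rw [← Finset.sum_div, div_mul_div_comm, ← key, mul_div_mul_left _ _ hs]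
end

section
/- For every natural number n ≥ 2, the subring of ℝ generated by the set of all diagonal lengths {μ_{n,k} : 1 ≤ k ≤ n−1} equals the subring of ℝ generated by the single element 2·cos(π/n) = ζ_{2n} + conj(ζ_{2n}); that is, the ring of diagonals ℤ[μ_n] coincides with ℤ[ζ_{2n} + conj(ζ_{2n})]. -/
open Real

theorem sin_mul_div_sin_mem_closure_two_mul_cos {θ : ℝ} (hθ : Real.sin θ ≠ 0) :
    ∀ k : ℕ, Real.sin (k * θ) / Real.sin θ ∈ Subring.closure {2 * Real.cos θ}
  | 0 => by simp
  | 1 => by simp [div_self hθ]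
  | k + 2 => by
    have h : Real.sin ((k + 2 : ℕ) * θ) / Real.sin θ =
        2 * Real.cos θ * (Real.sin ((k + 1 : ℕ) * θ) / Real.sin θ) -
          Real.sin (k * θ) / Real.sin θ := by
      have h₁ : ((k + 2 : ℕ) : ℝ) * θ = (k + 1 : ℕ) * θ + θ := by push_cast; ring
      have h₂ : (k : ℝ) * θ = (k + 1 : ℕ) * θ - θ := by push_cast; ring
      rw [h₁, h₂, Real.sin_add, Real.sin_sub]
      ring
    rw [h]
    exact sub_mem (mul_mem (Subring.subset_closure rfl)
      (sin_mul_div_sin_mem_closure_two_mul_cos hθ (k + 1)))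
      (sin_mul_div_sin_mem_closure_two_mul_cos hθ k)

/-- The subring of ℝ generated by all the diagonals μ_{n,k}, 1 ≤ k ≤ n−1, of a regular
n-gon equals the subring generated by 2·cos(π/n). -/
theorem ring_of_diagonals_eq (n : ℕ) (hn : 2 ≤ n) :
    Subring.closure {x : ℝ | ∃ k : ℕ, 1 ≤ k ∧ k ≤ n - 1 ∧
        x = Real.sin (k * Real.pi / n) / Real.sin (Real.pi / n)} =
      Subring.closure {2 * Real.cos (Real.pi / n)} := by
  have hn' : (2 : ℝ) ≤ n := by exact_mod_cast hn
  have hsin : Real.sin (Real.pi / n) ≠ 0 :=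
    (Real.sin_pos_of_pos_of_lt_pi (by positivity)
      (div_lt_self Real.pi_pos (by linarith))).ne'
  apply le_antisymm
  · rw [Subring.closure_le]
    rintro x ⟨k, -, -, rfl⟩
    rw [mul_div_assoc]
    exact sin_mul_div_sin_mem_closure_two_mul_cos hsin k
  · rw [Subring.closure_le, Set.singleton_subset_iff, SetLike.mem_coe]
    rcases hn.eq_or_lt with rfl | hn
    · simp
    · refine Subring.subset_closure ⟨2, by norm_num, by lia, ?_⟩
      rw [Nat.cast_ofNat, mul_div_assoc, Real.sin_two_mul]
      field_simp
end

section
/- For every natural number n ≥ 2, the set of real elements of the subring ℤ[ζ_{2n}] of ℂ generated by ζ_{2n} = exp(iπ/n) is exactly the subring of ℝ generated by 2·cos(π/n); that is, ℝ ∩ ℤ[ζ_{2n}] = ℤ[ζ_{2n} + conj(ζ_{2n})]. -/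
open Real Complex

/-- If `z ^ 2 = t * z - 1` with `t` real, then `ℤ[z] ⊆ ℤ[t] + ℤ[t] z`. -/
theorem exists_eq_add_mul_of_mem_closure {z : ℂ} {t : ℝ} (hz : z ^ 2 = t * z - 1) {w : ℂ}
    (hw : w ∈ Subring.closure {z}) :
    ∃ a ∈ Subring.closure {t}, ∃ b ∈ Subring.closure {t}, w = (a : ℂ) + b * z := by
  have ht : t ∈ Subring.closure {t} := Subring.subset_closure rfl
  induction hw using Subring.closure_induction with
  | mem w hw =>
    obtain rfl : w = z := hw
    exact ⟨0, zero_mem _, 1, one_mem _, by simp⟩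
  | zero => exact ⟨0, zero_mem _, 0, zero_mem _, by simp⟩
  | one => exact ⟨1, one_mem _, 0, zero_mem _, by simp⟩
  | add u v _ _ hu hv =>
    obtain ⟨a, ha, b, hb, rfl⟩ := hu
    obtain ⟨c, hc, d, hd, rfl⟩ := hv
    exact ⟨a + c, add_mem ha hc, b + d, add_mem hb hd, by push_cast; ring⟩
  | neg u _ hu =>
    obtain ⟨a, ha, b, hb, rfl⟩ := hu
    exact ⟨-a, neg_mem ha, -b, neg_mem hb, by push_cast; ring⟩
  | mul u v _ _ hu hv =>
    obtain ⟨a, ha, b, hb, rfl⟩ := hu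
    obtain ⟨c, hc, d, hd, rfl⟩ := hv
    refine ⟨a * c - b * d, sub_mem (mul_mem ha hc) (mul_mem hb hd),
      a * d + b * c + b * d * t,
      add_mem (add_mem (mul_mem ha hd) (mul_mem hb hc)) (mul_mem (mul_mem hb hd) ht), ?_⟩
    push_cast
    linear_combination (b * d : ℂ) * hz

/-- The real elements of ℤ[ζ_{2n}] ⊆ ℂ, ζ_{2n} = exp(iπ/n), are exactly the elements of
the subring of ℝ generated by 2·cos(π/n). -/
theorem real_part_of_cyclotomic_ring (n : ℕ) (hn : 2 ≤ n) (x : ℝ) :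
    (x : ℂ) ∈ Subring.closure {Complex.exp ((Real.pi : ℂ) * Complex.I / (n : ℂ))} ↔
      x ∈ Subring.closure {2 * Real.cos (Real.pi / n)} := by
  have hn0 : (n : ℂ) ≠ 0 := by exact_mod_cast (by omega : n ≠ 0)
  have harg : (Real.pi : ℂ) * Complex.I / (n : ℂ) = ((Real.pi / n : ℝ) : ℂ) * Complex.I := by
    push_cast
    ring
  set z := Complex.exp ((Real.pi : ℂ) * Complex.I / (n : ℂ)) with hzdef
  have hpow : z ^ (2 * n) = 1 := by
    rw [hzdef, ← Complex.exp_nat_mul, ← Complex.exp_two_pi_mul_I]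
    congr 1
    push_cast
    field_simp
  have hinv : z⁻¹ = z ^ (2 * n - 1) := by
    refine inv_eq_of_mul_eq_one_right ?_
    rw [← pow_succ', Nat.sub_add_cancel (by omega), hpow]
  have hcos : ((2 * Real.cos (Real.pi / n) : ℝ) : ℂ) = z + z⁻¹ := by
    rw [hzdef, ← Complex.exp_neg, harg, ← neg_mul]
    push_cast
    exact Complex.two_cos _
  constructor
  · intro hx
    have hz : z ^ 2 = (2 * Real.cos (Real.pi / n) : ℝ) * z - 1 := by
      rw [hcos, add_mul, inv_mul_cancel₀ (Complex.exp_ne_zero _)]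
      ring
    obtain ⟨a, ha, b, -, hab⟩ := exists_eq_add_mul_of_mem_closure hz hx
    have him : z.im = Real.sin (Real.pi / n) := by
      rw [hzdef, harg, Complex.exp_ofReal_mul_I_im]
    have hsin : 0 < Real.sin (Real.pi / n) :=
      Real.sin_pos_of_pos_of_lt_pi (by positivity)
        (div_lt_self Real.pi_pos (by exact_mod_cast (by omega : 1 < n)))
    have hb : b = 0 := by
      have h := congrArg Complex.im hab
      simp only [Complex.add_im, Complex.ofReal_im, Complex.im_ofReal_mul, him, zero_add] at h
      exact (mul_eq_zero.mp h.symm).resolve_right hsin.ne'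
    have hxa : x = a := by simpa [hb] using hab
    exact hxa ▸ ha
  · intro hx
    have hle : Subring.closure {2 * Real.cos (Real.pi / n)} ≤
        (Subring.closure {z}).comap Complex.ofRealHom := by
      rw [Subring.closure_le, Set.singleton_subset_iff]
      change ((2 * Real.cos (Real.pi / n) : ℝ) : ℂ) ∈ Subring.closure {z}
      have hmem : z ∈ Subring.closure {z} := Subring.subset_closure rfl
      rw [hcos, hinv]
      exact add_mem hmem (pow_mem hmem _)
    exact hle hx
end

section
/- For all natural numbers n ≥ 2 and 1 ≤ k ≤ n−1, the (n−1)×(n−1) matrix M_{n,k} with rows and columns indexed by j, m ∈ {1, …, n−1} and entries (M_{n,k})_{j,m} = 1 if |j−m| ≤ k−1, j+m ≥ k+1, j+m ≤ 2n−k−1 and j+m ≡ k+1 (mod 2), and 0 otherwise, satisfies M_{n,k}·v = μ_{n,k}·v, where v ∈ ℝ^{n−1} is the vector with components v_j = sin(jπ/n). -/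
open Real

/-- A telescoping sum of sines along an arithmetic progression with step two. -/
lemma two_mul_sin_mul_sum_sin_step_two (θ : ℝ) (a L : ℕ) :
    2 * sin θ * ∑ l ∈ Finset.range L, sin (((a + 2 * l : ℕ) + 1) * θ) =
      cos (a * θ) - cos ((a + 2 * L : ℕ) * θ) := by
  induction L with
  | zero => simp
  | succ L ih =>
    rw [Finset.sum_range_succ, mul_add, ih]
    have h₁ : ((a + 2 * L : ℕ) : ℝ) * θ = ((a + 2 * L : ℕ) + 1) * θ - θ := by ring
    have h₂ : ((a + 2 * (L + 1) : ℕ) : ℝ) * θ = ((a + 2 * L : ℕ) + 1) * θ + θ := by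
      push_cast; ring
    rw [h₂, cos_add, h₁, cos_sub]
    ring

/-- Summing over the indices `i ≡ a (mod 2)` in `[a, a + 2 * L)`. -/
lemma sum_range_ite_step_two (f : ℕ → ℝ) (N a L : ℕ) (h : a + 2 * L ≤ N + 1)
    (p : ℕ → Prop) [DecidablePred p]
    (hp : ∀ i < N, p i ↔ a ≤ i ∧ i < a + 2 * L ∧ i % 2 = a % 2) :
    ∑ i ∈ Finset.range N, (if p i then f i else 0) =
      ∑ l ∈ Finset.range L, f (a + 2 * l) := by
  rw [← Finset.sum_filter]
  symm
  refine Finset.sum_bij (fun l _ => a + 2 * l) ?_ ?_ ?_ ?_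
  · intro l hl
    simp only [Finset.mem_range, Finset.mem_filter] at hl ⊢
    refine ⟨by omega, (hp _ (by omega)).2 (by omega)⟩
  · intro l _ l' _ hll
    omega
  · intro i hi
    simp only [Finset.mem_range, Finset.mem_filter] at hi
    have := (hp i hi.1).1 hi.2
    exact ⟨(i - a) / 2, Finset.mem_range.2 (by omega), by omega⟩
  · intros; rfl

/-- The matrix M_{n,k} (indexed by j,m ∈ {1,…,n−1}, here represented via `Fin (n-1)`
with j ↦ j+1) with entries 1 when |j−m| ≤ k−1, j+m ≥ k+1, j+m ≤ 2n−k−1 and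
j+m ≡ k+1 (mod 2), has the vector v_j = sin(jπ/n) as eigenvector with eigenvalue
μ_{n,k} = sin(kπ/n)/sin(π/n). -/
theorem matrix_Mnk_eigenvector (n k : ℕ) (hn : 2 ≤ n) (hk : 1 ≤ k) (hkn : k ≤ n - 1)
    (M : Matrix (Fin (n - 1)) (Fin (n - 1)) ℝ)
    (hM : ∀ j m : Fin (n - 1),
      M j m = if |((j : ℤ) + 1) - ((m : ℤ) + 1)| ≤ (k : ℤ) - 1 ∧
          ((j : ℤ) + 1) + ((m : ℤ) + 1) ≥ (k : ℤ) + 1 ∧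
          ((j : ℤ) + 1) + ((m : ℤ) + 1) ≤ 2 * (n : ℤ) - (k : ℤ) - 1 ∧
          (((j : ℤ) + 1) + ((m : ℤ) + 1)) % 2 = ((k : ℤ) + 1) % 2
        then 1 else 0)
    (v : Fin (n - 1) → ℝ) (hv : ∀ j : Fin (n - 1), v j = Real.sin (((j : ℕ) + 1) * Real.pi / n)) :
    M.mulVec v = (Real.sin (k * Real.pi / n) / Real.sin (Real.pi / n)) • v := by
  have hn0 : (n : ℝ) ≠ 0 := by positivity
  have hs : 0 < sin (π / n) := by
    apply sin_pos_of_pos_of_lt_pi (by positivity)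
    exact div_lt_self pi_pos (by exact_mod_cast hn)
  ext j
  simp only [Matrix.mulVec, dotProduct, hM, hv, ite_mul, one_mul, zero_mul, Pi.smul_apply,
    smul_eq_mul]
  obtain ⟨j, hj⟩ := j
  dsimp only
  obtain ⟨a, ha⟩ : ∃ a : ℕ, (a : ℤ) = |(j : ℤ) + 1 - k| := ⟨_, Int.natCast_natAbs _⟩
  have ha' : (a : ℤ) = max ((j : ℤ) + 1 - k) (k - (j + 1)) := by
    rw [ha, abs_eq_max_neg, neg_sub]
  obtain ⟨L, hL⟩ : ∃ L : ℕ, (a : ℤ) + 2 * L = min ((j : ℤ) + 1 + k) (2 * n - (j + 1 + k)) := by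
    refine ⟨((min ((j : ℤ) + 1 + k) (2 * n - (j + 1 + k)) - a) / 2).toNat, ?_⟩
    clear ha
    omega
  have hcos_a : cos (a * (π / n)) = cos (((j : ℝ) + 1) * (π / n) - k * (π / n)) := by
    have h : (a : ℝ) = |(j : ℝ) + 1 - k| := by exact_mod_cast congrArg (Int.cast (R := ℝ)) ha
    rw [← sub_mul, h]
    rcases abs_choice ((j : ℝ) + 1 - k) with h | h <;> rw [h]
    rw [neg_mul, cos_neg]
  have hcos_b : cos ((a + 2 * L : ℕ) * (π / n)) =
      cos (((j : ℝ) + 1) * (π / n) + k * (π / n)) := by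
    rw [← add_mul]
    rcases min_choice ((j : ℤ) + 1 + k) (2 * n - (j + 1 + k)) with h | h <;> rw [h] at hL
    · have h' : ((a + 2 * L : ℕ) : ℝ) = (j : ℝ) + 1 + k := by exact_mod_cast hL
      rw [h']
    · have h' : ((a + 2 * L : ℕ) : ℝ) = 2 * n - ((j : ℝ) + 1 + k) := by
        exact_mod_cast congrArg (Int.cast (R := ℝ)) hL
      have h'' : (2 * n - ((j : ℝ) + 1 + k)) * (π / n) =
          2 * π - ((j : ℝ) + 1 + k) * (π / n) := by
        field_simp
      rw [h', h'', cos_two_pi_sub]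
  have htel := two_mul_sin_mul_sum_sin_step_two (π / n) a L
  rw [hcos_a, hcos_b, cos_sub, cos_add] at htel
  rw [Fin.sum_univ_eq_sum_range (fun i : ℕ =>
    if |((j : ℤ) + 1) - ((i : ℤ) + 1)| ≤ (k : ℤ) - 1 ∧
          ((j : ℤ) + 1) + ((i : ℤ) + 1) ≥ (k : ℤ) + 1 ∧
          ((j : ℤ) + 1) + ((i : ℤ) + 1) ≤ 2 * (n : ℤ) - (k : ℤ) - 1 ∧
          (((j : ℤ) + 1) + ((i : ℤ) + 1)) % 2 = ((k : ℤ) + 1) % 2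
        then sin (((i : ℕ) + 1) * π / n) else 0) (n - 1),
    sum_range_ite_step_two (fun i => sin (((i : ℕ) + 1) * π / n)) (n - 1) a L (by omega) _
      (by intro i hi; rw [abs_le]; omega)]
  simp only [mul_div_assoc]
  rw [div_mul_eq_mul_div, eq_div_iff hs.ne']
  linarith
end

section
/- For every natural number n ≥ 2 and every choice of nonnegative integer coefficients c_1, …, c_{⌊n/2⌋} (not all zero), the matrix M_n = ∑_{k=1}^{⌊n/2⌋} c_k·M_{n,k} satisfies M_n·v = λ·v with eigenvalue λ = ∑_{k=1}^{⌊n/2⌋} c_k·μ_{n,k}, where v ∈ ℝ^{n−1} has components v_j = sin(jπ/n), M_{n,k} is the (n−1)×(n−1) matrix with entries (M_{n,k})_{j,m} = 1 if |j−m| ≤ k−1, j+m ≥ k+1, j+m ≤ 2n−k−1 and j+m ≡ k+1 (mod 2), and 0 otherwise. -/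
open Real

/-- Telescoping sum of sines over an arithmetic progression of step `2θ`. -/
theorem two_mul_sin_mul_sum_sin (θ : ℝ) (a N : ℕ) :
    2 * Real.sin θ * ∑ i ∈ Finset.range N, Real.sin (((a + 2 * i : ℕ) + 1) * θ) =
      Real.cos (a * θ) - Real.cos ((a + 2 * N : ℕ) * θ) := by
  induction N with
  | zero => simp
  | succ N ih =>
    rw [Finset.sum_range_succ, mul_add, ih, Real.two_mul_sin_mul_sin]
    have h₁ : θ - ((a + 2 * N : ℕ) + 1) * θ = -((a + 2 * N : ℕ) * θ) := by ring
    have h₂ : θ + ((a + 2 * N : ℕ) + 1) * θ = (a + 2 * (N + 1) : ℕ) * θ := by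
      push_cast
      ring
    rw [h₁, h₂, Real.cos_neg]
    ring

/-- Product formula for diagonals of the regular `n`-gon: `μ_k sin (jπ/n)` is the sum of the
`sin (mπ/n)` over the `m` allowed by the (truncated) Clebsch-Gordan rule. Here `j` and `m` are
shifted by one. -/
theorem sum_ite_sin_eq_sin_div_mul_sin {n k j : ℕ} (hk : 1 ≤ k) (hkn : k < n) (hj : j + 1 < n) :
    (∑ m ∈ Finset.range (n - 1),
      if |((j : ℤ) + 1) - ((m : ℤ) + 1)| ≤ (k : ℤ) - 1 ∧
          ((j : ℤ) + 1) + ((m : ℤ) + 1) ≥ (k : ℤ) + 1 ∧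
          ((j : ℤ) + 1) + ((m : ℤ) + 1) ≤ 2 * (n : ℤ) - (k : ℤ) - 1 ∧
          (((j : ℤ) + 1) + ((m : ℤ) + 1)) % 2 = ((k : ℤ) + 1) % 2
        then Real.sin ((m + 1) * (Real.pi / n)) else 0) =
      Real.sin (k * (Real.pi / n)) / Real.sin (Real.pi / n) *
        Real.sin ((j + 1) * (Real.pi / n)) := by
  have hn : (1 : ℝ) < n := by exact_mod_cast (by omega : 1 < n)
  have hn₀ : (n : ℝ) ≠ 0 := by positivity
  have hsin : Real.sin (Real.pi / n) ≠ 0 :=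
    (Real.sin_pos_of_pos_of_lt_pi (by positivity) (div_lt_self Real.pi_pos hn)).ne'
  obtain ⟨a, ha⟩ : ∃ a, a = (j + 1 - k) + (k - (j + 1)) := ⟨_, rfl⟩
  obtain ⟨N, hN⟩ : ∃ N, N = min (min (j + 1) k) (min (n - (j + 1)) (n - k)) := ⟨_, rfl⟩
  have hsum := two_mul_sin_mul_sum_sin (Real.pi / n) a N
  have hlo : Real.cos (a * (Real.pi / n)) = Real.cos ((k - (j + 1)) * (Real.pi / n)) := by
    rcases le_total k (j + 1) with h | h
    · have : (a : ℝ) = -(k - (j + 1)) := by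
        rw [show a = j + 1 - k by omega, Nat.cast_sub h]
        push_cast
        ring
      rw [this, neg_mul, Real.cos_neg]
    · rw [show a = k - (j + 1) by omega, Nat.cast_sub h]
      push_cast
      rfl
  have hhi : Real.cos ((a + 2 * N : ℕ) * (Real.pi / n)) =
      Real.cos ((k + (j + 1)) * (Real.pi / n)) := by
    rcases le_total (k + (j + 1)) n with h | h
    · rw [show a + 2 * N = k + (j + 1) by omega]
      push_cast
      rfl
    · have hcast : ((a + 2 * N : ℕ) : ℝ) = 2 * n - (k + (j + 1)) := by
        rw [eq_sub_iff_add_eq]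
        exact_mod_cast (by omega : a + 2 * N + (k + (j + 1)) = 2 * n)
      have harg : (2 * (n : ℝ) - (k + (j + 1))) * (Real.pi / n) =
          2 * Real.pi - (k + (j + 1)) * (Real.pi / n) := by
        field_simp
      rw [hcast, harg, Real.cos_two_pi_sub]
  rw [hlo, hhi, sub_mul _ _ (Real.pi / n), add_mul (k : ℝ), ← Real.two_mul_sin_mul_sin] at hsum
  rw [← Finset.sum_filter, div_mul_eq_mul_div, eq_div_iff hsin]
  have hbij : ∑ i ∈ Finset.range N, Real.sin (((a + 2 * i : ℕ) + 1) * (Real.pi / n)) =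
      ∑ m ∈ (Finset.range (n - 1)).filter (fun m : ℕ => |((j : ℤ) + 1) - ((m : ℤ) + 1)| ≤ (k : ℤ) - 1 ∧
          ((j : ℤ) + 1) + ((m : ℤ) + 1) ≥ (k : ℤ) + 1 ∧
          ((j : ℤ) + 1) + ((m : ℤ) + 1) ≤ 2 * (n : ℤ) - (k : ℤ) - 1 ∧
          (((j : ℤ) + 1) + ((m : ℤ) + 1)) % 2 = ((k : ℤ) + 1) % 2),
        Real.sin ((m + 1) * (Real.pi / n)) := by
    refine Finset.sum_nbij' (fun i => a + 2 * i) (fun m => (m - a) / 2) ?_ ?_ ?_ ?_ ?_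
    · intro i hi
      simp only [Finset.mem_range, Finset.mem_filter, abs_le] at hi ⊢
      omega
    · intro m hm
      simp only [Finset.mem_range, Finset.mem_filter, abs_le] at hm ⊢
      omega
    · intro i _
      omega
    · intro m hm
      simp only [Finset.mem_range, Finset.mem_filter, abs_le] at hm ⊢
      omega
    · intro i _
      rfl
  rw [← hbij]
  linarith

/-- For nonnegative integer coefficients c_1,…,c_{⌊n/2⌋}, not all zero, the matrix
M_n = ∑_{k=1}^{⌊n/2⌋} c_k·M_{n,k} has the vector v_j = sin(jπ/n) as eigenvector with
eigenvalue λ = ∑_{k=1}^{⌊n/2⌋} c_k·μ_{n,k}. -/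
theorem substitution_matrix_eigenvector (n : ℕ) (hn : 2 ≤ n) (c : ℕ → ℕ)
    (hc : ∃ k ∈ Finset.Icc 1 (n / 2), c k ≠ 0)
    (Mk : ℕ → Matrix (Fin (n - 1)) (Fin (n - 1)) ℝ)
    (hMk : ∀ k : ℕ, ∀ j m : Fin (n - 1),
      Mk k j m = if |((j : ℤ) + 1) - ((m : ℤ) + 1)| ≤ (k : ℤ) - 1 ∧
          ((j : ℤ) + 1) + ((m : ℤ) + 1) ≥ (k : ℤ) + 1 ∧
          ((j : ℤ) + 1) + ((m : ℤ) + 1) ≤ 2 * (n : ℤ) - (k : ℤ) - 1 ∧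
          (((j : ℤ) + 1) + ((m : ℤ) + 1)) % 2 = ((k : ℤ) + 1) % 2
        then 1 else 0)
    (v : Fin (n - 1) → ℝ) (hv : ∀ j : Fin (n - 1), v j = Real.sin (((j : ℕ) + 1) * Real.pi / n)) :
    (∑ k ∈ Finset.Icc 1 (n / 2), (c k : ℝ) • Mk k).mulVec v =
      (∑ k ∈ Finset.Icc 1 (n / 2),
        (c k : ℝ) * (Real.sin (k * Real.pi / n) / Real.sin (Real.pi / n))) • v := by
  ext j
  rw [Matrix.sum_mulVec, Finset.sum_apply, Pi.smul_apply, smul_eq_mul, Finset.sum_mul]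
  refine Finset.sum_congr rfl fun k hk => ?_
  rw [Finset.mem_Icc] at hk
  rw [Matrix.smul_mulVec, Pi.smul_apply, smul_eq_mul, mul_assoc]
  congr 1
  have hjn := j.isLt
  have key := sum_ite_sin_eq_sin_div_mul_sin (n := n) (k := k) (j := j) hk.1 (by omega) (by omega)
  rw [Finset.sum_range] at key
  simp only [Matrix.mulVec, dotProduct, hMk, hv, mul_div_assoc, ite_mul, one_mul, zero_mul]
  exact key
end

section
/- For every even natural number n ≥ 4, every odd k with 1 ≤ k ≤ n−1, and every natural number p ≥ 1, the power μ_{n,k}^p lies in the additive submonoid of ℝ generated by the odd-index diagonals {μ_{n,j} : j odd, 1 ≤ j ≤ n−1}; moreover, for every even k with 2 ≤ k ≤ n−2 and every even p ≥ 2, μ_{n,k}^p also lies in this submonoid. -/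
open Real

/-- The length of the `k`-th diagonal of a regular `n`-gon with side length one. -/
noncomputable def polygonDiagonal (n k : ℕ) : ℝ :=
  Real.sin (k * Real.pi / n) / Real.sin (Real.pi / n)

/-- The additive submonoid of `ℝ` generated by the odd-index diagonals. -/
noncomputable def oddDiagonalSubmonoid (n : ℕ) : AddSubmonoid ℝ :=
  AddSubmonoid.closure {x : ℝ | ∃ j : ℕ, Odd j ∧ 1 ≤ j ∧ j ≤ n - 1 ∧ x = polygonDiagonal n j}

lemma sin_add_mul_sin_add (x y t : ℝ) :
    Real.sin (x + t) * Real.sin (y + t) =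
      Real.sin x * Real.sin y + Real.sin t * Real.sin (x + y + t) := by
  simp only [Real.sin_add, Real.cos_add]
  linear_combination (Real.sin x * Real.sin y) * Real.sin_sq_add_cos_sq t

lemma sin_pi_div_pos {n : ℕ} (hn : 2 ≤ n) : 0 < Real.sin (Real.pi / n) := by
  have hn' : (2 : ℝ) ≤ n := by exact_mod_cast hn
  exact Real.sin_pos_of_pos_of_lt_pi (by positivity)
    (div_lt_self Real.pi_pos (by linarith))

lemma polygonDiagonal_zero (n : ℕ) : polygonDiagonal n 0 = 0 := by
  simp [polygonDiagonal]

lemma polygonDiagonal_one {n : ℕ} (hn : 2 ≤ n) : polygonDiagonal n 1 = 1 := by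
  simp [polygonDiagonal, (sin_pi_div_pos hn).ne']

lemma polygonDiagonal_sub {n k : ℕ} (hn : n ≠ 0) (hk : k ≤ n) :
    polygonDiagonal n (n - k) = polygonDiagonal n k := by
  have h : ((n - k : ℕ) : ℝ) * Real.pi / n = Real.pi - k * Real.pi / n := by
    rw [Nat.cast_sub hk]
    field_simp
  rw [polygonDiagonal, h, Real.sin_pi_sub, polygonDiagonal]

lemma polygonDiagonal_succ_mul_succ {n : ℕ} (hn : 2 ≤ n) (k l : ℕ) :
    polygonDiagonal n (k + 1) * polygonDiagonal n (l + 1) =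
      polygonDiagonal n k * polygonDiagonal n l + polygonDiagonal n (k + l + 1) := by
  have hs := (sin_pi_div_pos hn).ne'
  have h := sin_add_mul_sin_add (k * Real.pi / n) (l * Real.pi / n) (Real.pi / n)
  simp only [polygonDiagonal, Nat.cast_add, Nat.cast_one, add_mul, one_mul, add_div]
  field_simp at h ⊢
  linear_combination h

lemma polygonDiagonal_mem {n j : ℕ} (hj : Odd j) (hjn : j < n) :
    polygonDiagonal n j ∈ oddDiagonalSubmonoid n :=
  AddSubmonoid.subset_closure ⟨j, hj, hj.pos, by omega, rfl⟩

lemma polygonDiagonal_add_mul_mem {n d : ℕ} (hn : 2 ≤ n) (hd : Even d) (l : ℕ)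
    (h : d + 2 * l ≤ n) :
    polygonDiagonal n (d + l) * polygonDiagonal n l ∈ oddDiagonalSubmonoid n := by
  induction l with
  | zero => simp [polygonDiagonal_zero]
  | succ l ih =>
    rw [← add_assoc, polygonDiagonal_succ_mul_succ hn]
    refine add_mem (ih (by omega)) (polygonDiagonal_mem ?_ (by omega))
    grind

lemma polygonDiagonal_mul_mem {n k l : ℕ} (hn : 2 ≤ n) (heven : Even n)
    (hk : k ≤ n) (hl : l ≤ n) (hkl : Even (k + l)) :
    polygonDiagonal n k * polygonDiagonal n l ∈ oddDiagonalSubmonoid n := by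
  wlog hk' : 2 * k ≤ n generalizing k
  · rw [← polygonDiagonal_sub (by omega) hk]
    exact this (by omega) (by grind) (by omega)
  wlog hl' : 2 * l ≤ n generalizing l
  · rw [← polygonDiagonal_sub (by omega) hl]
    exact this (by omega) (by grind) (by omega)
  wlog hle : l ≤ k generalizing k l
  · rw [mul_comm]
    exact this hl hl' hk (by rwa [add_comm]) hk' (by omega)
  obtain ⟨d, rfl⟩ := Nat.exists_eq_add_of_le' hle
  exact polygonDiagonal_add_mul_mem hn (by grind) l (by omega)

open scoped Pointwise in
lemma mul_mem_oddDiagonalSubmonoid {n : ℕ} (hn : 2 ≤ n) (heven : Even n) {x y : ℝ}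
    (hx : x ∈ oddDiagonalSubmonoid n) (hy : y ∈ oddDiagonalSubmonoid n) :
    x * y ∈ oddDiagonalSubmonoid n := by
  have hmul : oddDiagonalSubmonoid n * oddDiagonalSubmonoid n ≤ oddDiagonalSubmonoid n := by
    conv_lhs => rw [oddDiagonalSubmonoid, AddSubmonoid.closure_mul_closure]
    rw [AddSubmonoid.closure_le]
    rintro _ ⟨_, ⟨i, hi, -, hin, rfl⟩, _, ⟨j, hj, -, hjn, rfl⟩, rfl⟩
    exact polygonDiagonal_mul_mem hn heven (by omega) (by omega) (hi.add_odd hj)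
  exact hmul (AddSubmonoid.mul_mem_mul hx hy)

lemma pow_mem_oddDiagonalSubmonoid {n : ℕ} (hn : 2 ≤ n) (heven : Even n) {x : ℝ}
    (hx : x ∈ oddDiagonalSubmonoid n) (p : ℕ) : x ^ p ∈ oddDiagonalSubmonoid n := by
  induction p with
  | zero =>
    rw [pow_zero, ← polygonDiagonal_one hn]
    exact polygonDiagonal_mem odd_one (by omega)
  | succ p ih =>
    rw [pow_succ]
    exact mul_mem_oddDiagonalSubmonoid hn heven ih hx

/-- For even n ≥ 4, powers μ_{n,k}^p of odd-index diagonals (any p ≥ 1), and even powers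
of even-index diagonals, lie in the additive submonoid of ℝ generated by the odd-index
diagonals. -/
theorem diagonal_powers_in_S_odd (n : ℕ) (hn : 4 ≤ n) (heven : Even n) :
    (∀ k : ℕ, Odd k → 1 ≤ k → k ≤ n - 1 → ∀ p : ℕ, 1 ≤ p →
      (Real.sin (k * Real.pi / n) / Real.sin (Real.pi / n)) ^ p ∈
        AddSubmonoid.closure {x : ℝ | ∃ j : ℕ, Odd j ∧ 1 ≤ j ∧ j ≤ n - 1 ∧
          x = Real.sin (j * Real.pi / n) / Real.sin (Real.pi / n)}) ∧
    (∀ k : ℕ, Even k → 2 ≤ k → k ≤ n - 2 → ∀ p : ℕ, Even p → 2 ≤ p →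
      (Real.sin (k * Real.pi / n) / Real.sin (Real.pi / n)) ^ p ∈
        AddSubmonoid.closure {x : ℝ | ∃ j : ℕ, Odd j ∧ 1 ≤ j ∧ j ≤ n - 1 ∧
          x = Real.sin (j * Real.pi / n) / Real.sin (Real.pi / n)}) := by
  have hn2 : 2 ≤ n := by omega
  constructor
  · intro k hk _ hkn p _
    exact pow_mem_oddDiagonalSubmonoid hn2 heven (polygonDiagonal_mem hk (by omega)) p
  · rintro k - - hkn p ⟨q, rfl⟩ -
    rw [← two_mul, pow_mul, sq]
    exact pow_mem_oddDiagonalSubmonoid hn2 heven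
      (polygonDiagonal_mul_mem hn2 heven (by omega) (by omega) ⟨k, rfl⟩) q
end
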